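/- arXiv:1410.7506 — 3 statements merged into one kernel-verified Lean document; each statement's English description precedes it below -/
import Mathlib

section
/- Let τ be a finite rooted tree with root h, and let p : V(τ) → [0, 1/4) satisfy ∏_{u child of v} (1 − 4·p_u) ≥ 3/4 for every vertex v of τ. Then for every integer L ≥ 1, Σ_S ∏_{k∈S} p_k ≤ 3^{−L}, where the sum is over all subsets S ⊆ V(τ) with |S| = L that contain h and induce a connected subtree of τ. -/
open Finset

noncomputable section

open scoped Classical

/-- The (undirected) graph of a rooted tree given by its parent map: `u` and `v` are
adjacent iff one is the parent of the other. -/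
def treeGraph {V : Type*} (par : V → V) : SimpleGraph V :=
  SimpleGraph.fromRel (fun u v => par u = v)

theorem par_mem_of_induce_treeGraph_connected {V : Type*} {par : V → V} {h : V} (hroot : par h = h)
    {S : Finset V} (hS : h ∈ S)
    (hconn : (SimpleGraph.induce (↑S : Set V) (treeGraph par)).Connected)
    {v : V} (hv : v ∈ S) : par v ∈ S := by
  by_contra hpv
  have descend : ∀ a b : (↑S : Set V),
      (SimpleGraph.induce (↑S : Set V) (treeGraph par)).Walk a b →
      (∃ n : ℕ, par^[n] a = v) → ∃ n : ℕ, par^[n] b = v := by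
    intro a b w
    induction w with
    | nil => exact id
    | @cons a b c hab _ ih =>
      rintro ⟨n, hn⟩
      apply ih
      have hadj : par a = b ∨ par b = a := hab.2
      rcases hadj with hab | hba
      · cases n with
        | zero =>
          obtain rfl : (a : V) = v := hn
          exact absurd (hab ▸ b.2) hpv
        | succ n => exact ⟨n, by rwa [Function.iterate_succ_apply, hab] at hn⟩
      · exact ⟨n + 1, by rwa [Function.iterate_succ_apply, hba]⟩
  obtain ⟨w⟩ := hconn.preconnected ⟨v, hv⟩ ⟨h, hS⟩
  obtain ⟨n, hn⟩ := descend _ _ w ⟨0, rfl⟩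
  have hvh : h = v := (Function.iterate_fixed hroot n).symm.trans hn
  exact hpv (by rwa [← hvh, hroot])

/-- The vertices outside `S` whose parent lies in `S`. -/
def childBoundary {V : Type*} [Fintype V] [DecidableEq V] (par : V → V) (S : Finset V) : Finset V :=
  {u | par u ∈ S ∧ u ∉ S}

theorem subset_of_disjoint_childBoundary {V : Type*} [Fintype V] [DecidableEq V]
    {par : V → V} {h : V}
    (hreach : ∀ v, ∃ n : ℕ, par^[n] v = h) {S T X : Finset V} (hT : h ∈ T)
    (hS : ∀ v ∈ S, par v ∈ S) (hSX : S ⊆ X) (hTX : Disjoint (childBoundary par T) X) :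
    S ⊆ T := by
  intro v hv
  obtain ⟨n, hn⟩ := hreach v
  induction n generalizing v with
  | zero => exact (show v = h from hn) ▸ hT
  | succ n ih =>
    by_contra hvT
    have hvb : v ∈ childBoundary par T := by
      simp only [childBoundary, mem_filter, mem_univ, true_and]
      exact ⟨ih (hS v hv) hn, hvT⟩
    exact Finset.disjoint_left.1 hTX hvb (hSX hv)

theorem prod_childBoundary_ge {V : Type*} [Fintype V] [DecidableEq V]
    {par : V → V} {f : V → ℝ} {c : ℝ} (hc : 0 ≤ c)
    (hf0 : ∀ v, 0 ≤ f v) (hf1 : ∀ v, f v ≤ 1)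
    (hprod : ∀ v, c ≤ ∏ u ∈ Finset.univ.filter (fun u => par u = v ∧ u ≠ v), f u)
    (S : Finset V) : c ^ #S ≤ ∏ u ∈ childBoundary par S, f u := by
  rw [← Finset.prod_fiberwise_of_maps_to (g := par) (t := S)
    (fun u hu => (Finset.mem_filter.1 hu).2.1), ← Finset.prod_const]
  refine Finset.prod_le_prod (fun _ _ => hc) fun v hv => (hprod v).trans ?_
  have hsub : (childBoundary par S).filter (fun u => par u = v) ⊆
      Finset.univ.filter (fun u => par u = v ∧ u ≠ v) := by
    intro u hu
    simp only [childBoundary, mem_filter, mem_univ, true_and] at hu ⊢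
    exact ⟨hu.2, fun huv => hu.1.2 (huv ▸ hv)⟩
  rw [← Finset.prod_sdiff hsub]
  exact mul_le_of_le_one_left (Finset.prod_nonneg fun u _ => hf0 u)
    (Finset.prod_le_one (fun u _ => hf0 u) fun u _ => hf1 u)

/-- The probability that a random subset, containing each `v` independently with probability
`q v`, contains `S` and avoids `B`. -/
theorem sum_prod_mul_prod_compl_of_subset_of_disjoint {V : Type*} [Fintype V] [DecidableEq V]
    (q : V → ℝ) {S B : Finset V} (hSB : Disjoint S B) :
    ∑ X : Finset V with S ⊆ X ∧ Disjoint B X, (∏ v ∈ X, q v) * ∏ v ∈ Xᶜ, (1 - q v) =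
      (∏ v ∈ S, q v) * ∏ v ∈ B, (1 - q v) := by
  have key := Finset.prod_add (fun v => if v ∈ B then 0 else q v)
    (fun v => if v ∈ S then 0 else 1 - q v) Finset.univ
  have hprod : ∏ v, ((if v ∈ B then 0 else q v) + (if v ∈ S then 0 else 1 - q v)) =
      (∏ v ∈ S, q v) * ∏ v ∈ B, (1 - q v) := by
    rw [← Fintype.prod_ite_mem S, ← Fintype.prod_ite_mem B, ← Finset.prod_mul_distrib]
    refine Finset.prod_congr rfl fun v _ => ?_
    have hv : v ∈ S → v ∉ B := fun hS => Finset.disjoint_left.1 hSB hS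
    by_cases hS : v ∈ S <;> by_cases hB : v ∈ B <;> simp_all
  rw [← hprod, key, Finset.powerset_univ, Finset.sum_filter]
  refine Finset.sum_congr rfl fun X _ => ?_
  rw [← Finset.compl_eq_univ_sdiff]
  split_ifs with hX
  · congr 1
    · exact Finset.prod_congr rfl fun v hv =>
        (if_neg fun hB => Finset.disjoint_left.1 hX.2 hB hv).symm
    · exact Finset.prod_congr rfl fun v hv =>
        (if_neg fun hS => Finset.mem_compl.1 hv (hX.1 hS)).symm
  · rw [not_and_or, Finset.not_subset, Finset.not_disjoint_iff (s := B)] at hX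
    obtain ⟨v, hS, hv⟩ | ⟨v, hB, hv⟩ := hX
    · exact Eq.symm <| mul_eq_zero_of_right _ <|
        Finset.prod_eq_zero (Finset.mem_compl.2 hv) (if_pos hS)
    · exact Eq.symm <| mul_eq_zero_of_left (Finset.prod_eq_zero hv <| by exact if_pos hB) _

/-- Weights of pairwise incompatible events, that a set contains `S` and avoids `B S`, sum to at most `1`. -/
theorem sum_prod_mul_prod_le_one {V : Type*} [Fintype V] [DecidableEq V]
    {q : V → ℝ} (hq0 : ∀ v, 0 ≤ q v) (hq1 : ∀ v, q v ≤ 1)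
    (F : Finset (Finset V)) (B : Finset V → Finset V) (hB : ∀ S ∈ F, Disjoint S (B S))
    (hF : ∀ S ∈ F, ∀ T ∈ F, ∀ X, S ⊆ X → Disjoint (B S) X → T ⊆ X → Disjoint (B T) X → S = T) :
    ∑ S ∈ F, (∏ v ∈ S, q v) * ∏ v ∈ B S, (1 - q v) ≤ 1 := by
  have hdisj : (F : Set (Finset V)).PairwiseDisjoint
      fun S => ({X | S ⊆ X ∧ Disjoint (B S) X} : Finset (Finset V)) := by
    intro S hS T hT hne
    refine Finset.disjoint_left.2 fun X hX hX' => hne ?_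
    simp only [mem_filter, mem_univ, true_and] at hX hX'
    exact hF S hS T hT X hX.1 hX.2 hX'.1 hX'.2
  rw [Finset.sum_congr rfl fun S hS =>
    (sum_prod_mul_prod_compl_of_subset_of_disjoint q (hB S hS)).symm, ← Finset.sum_biUnion hdisj]
  have htotal : ∑ X : Finset V, (∏ v ∈ X, q v) * ∏ v ∈ Xᶜ, (1 - q v) = 1 := by
    simpa using sum_prod_mul_prod_compl_of_subset_of_disjoint q
      (Finset.disjoint_empty_left ∅)
  refine (Finset.sum_le_sum_of_subset_of_nonneg (Finset.subset_univ _) fun X _ _ => ?_).trans_eq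
    htotal
  exact mul_nonneg (Finset.prod_nonneg fun v _ => hq0 v)
    (Finset.prod_nonneg fun v _ => sub_nonneg.2 (hq1 v))

/-- **Galton–Watson style bound.** Let `τ` be a finite rooted tree with root `h`
(given by a parent map `par` with `par h = h` and all vertices reaching `h`), and let
`p : V → [0, 1/4)` satisfy `∏_{u child of v} (1 - 4 p u) ≥ 3/4` for every vertex `v`.
Then for every `L ≥ 1`, the sum of `∏_{k ∈ S} p k` over all subsets `S` of size `L`
containing `h` that induce a connected subtree is at most `3^{-L}`. -/
theorem branching_process_bound
    (V : Type) [Fintype V] [DecidableEq V]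
    (h : V) (par : V → V) (p : V → ℝ)
    (hroot : par h = h)
    (hreach : ∀ v, ∃ n : ℕ, par^[n] v = h)
    (hp0 : ∀ v, 0 ≤ p v) (hp4 : ∀ v, p v < 1 / 4)
    (hprod : ∀ v : V,
      (3 : ℝ) / 4 ≤ ∏ u ∈ Finset.univ.filter (fun u => par u = v ∧ u ≠ v), (1 - 4 * p u)) :
    ∀ L : ℕ, 1 ≤ L →
      ∑ S ∈ Finset.univ.filter (fun S : Finset V =>
          h ∈ S ∧ S.card = L ∧
          (SimpleGraph.induce (↑S : Set V) (treeGraph par)).Connected),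
        ∏ k ∈ S, p k ≤ ((3 : ℝ))⁻¹ ^ L := by
  intro L _
  set F := Finset.univ.filter (fun S : Finset V =>
    h ∈ S ∧ S.card = L ∧ (SimpleGraph.induce (↑S : Set V) (treeGraph par)).Connected)
  have hF : ∀ S ∈ F, h ∈ S ∧ S.card = L ∧
      (SimpleGraph.induce (↑S : Set V) (treeGraph par)).Connected :=
    fun S hS => (Finset.mem_filter.1 hS).2
  have hpar : ∀ S ∈ F, ∀ v ∈ S, par v ∈ S := fun S hS v hv =>
    par_mem_of_induce_treeGraph_connected hroot (hF S hS).1 (hF S hS).2.2 hv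
  have hq0 : ∀ v, 0 ≤ 4 * p v := fun v => by linarith [hp0 v]
  have hq1 : ∀ v, 4 * p v ≤ 1 := fun v => by linarith [hp4 v]
  have hone := sum_prod_mul_prod_le_one hq0 hq1 F (childBoundary par)
    (fun S _ => Finset.disjoint_left.2 fun v hv hv' => (Finset.mem_filter.1 hv').2.2 hv)
    (fun S hS T hT X hSX hBS hTX hBT =>
      (subset_of_disjoint_childBoundary hreach (hF T hT).1 (hpar S hS) hSX hBT).antisymm
        (subset_of_disjoint_childBoundary hreach (hF S hS).1 (hpar T hT) hTX hBS))
  have hterm : ∀ S ∈ F, (∏ v ∈ S, p v) * 3 ^ L ≤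
      (∏ v ∈ S, 4 * p v) * ∏ v ∈ childBoundary par S, (1 - 4 * p v) := by
    intro S hS
    have hge := prod_childBoundary_ge (by norm_num) (fun v => sub_nonneg.2 (hq1 v))
      (fun v => by linarith [hq0 v]) hprod S
    rw [(hF S hS).2.1] at hge
    calc (∏ v ∈ S, p v) * 3 ^ L = (∏ v ∈ S, 4 * p v) * (3 / 4) ^ L := by
          rw [Finset.prod_mul_distrib, Finset.prod_const, (hF S hS).2.1,
            show (3 : ℝ) = 4 * (3 / 4) by norm_num, mul_pow]
          ring
      _ ≤ _ := mul_le_mul_of_nonneg_left hge (Finset.prod_nonneg fun v _ => hq0 v)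
  rw [inv_pow, ← one_div, le_div_iff₀ (by positivity), Finset.sum_mul]
  exact (Finset.sum_le_sum hterm).trans hone
end
end

section
/- Let I be a (q,q,0)-canonical instance with q sufficiently large, let c_1 = 12, c_2 = 300, c_3 = 200 and δ_0 = (34·c_2·c_3·log q)^{-1} (red machines defined with parameter δ_0). Consider the random valid assignment in which, independently for each heavy job j, f(j) is chosen from a subset M'_j ⊆ M_j with Σ_{i∈M'_j} z_i ≥ 0.49·Σ_{i∈M_j} z_i, with Pr[f(j) = i] = z_i / Σ_{i'∈M'_j} z_{i'}; write X = f(J_H), so each machine i lies in X with probability p_i ≤ 11·z_i. Then: (1) for every machine h, Pr[Σ_{k∈X∩R} w_{h,k} > c_1·log q] ≤ q^{−c_1}; (2) for every set T ⊆ M, Pr[T ⊆ X] ≤ ∏_{i∈T} p_i; (3) for every machine h, Pr[|{k ∈ X∩R : (h,k) is dense}| > 17·c_2·log q] ≤ q^{−c_2}; (4) for every in-sparse machine h, Pr[Σ_{k∈X∩R} (w_{k,h}(1−z_h) + w_{h,k}·z_k) > 0.1] ≤ q^{−c_2}. -/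
open Finset

noncomputable section

open scoped Classical

/-- `wSum w S T = Σ_{h ∈ S, k ∈ T} w h k`. -/
def wSum {M : Type*} (w : M → M → ℝ) (S T : Finset M) : ℝ :=
  ∑ h ∈ S, ∑ k ∈ T, w h k

/-- A canonical instance: pairwise-disjoint machine sets for the heavy jobs, a nonnegative
light-load matrix `w`, and `z : M → [0, 0.4]` with `z i = 0` iff `i` is in no `Mach j`. -/
def IsCanonical {M JH : Type*} (Mach : JH → Finset M) (w : M → M → ℝ) (z : M → ℝ) : Prop :=
  Pairwise (fun j j' : JH => Disjoint (Mach j) (Mach j')) ∧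
  (∀ h k, 0 ≤ w h k) ∧
  (∀ h k, h ≠ k → z k = 0 → w h k = 0) ∧
  (∀ h, 0 < z h → w h h = 0) ∧
  (∀ i, 0 ≤ z i ∧ z i ≤ 0.4) ∧
  (∀ i, z i = 0 ↔ ∀ j, i ∉ Mach j)

/-- A `(p, q, θ)`-canonical instance. -/
def IsPQCanonical {M JH : Type*} [Fintype M] (Mach : JH → Finset M) (w : M → M → ℝ)
    (z : M → ℝ) (p q θ : ℝ) : Prop :=
  IsCanonical Mach w z ∧
  1 ≤ p ∧ 1 ≤ q ∧ 0 ≤ θ ∧ θ < 0.2 ∧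
  (∀ i, z i = 0 ∨ 1 / p ≤ z i) ∧
  (∀ h k, w h k = 0 ∨ 1 / q ≤ w h k) ∧
  (∀ j, 0.2 - θ ≤ ∑ i ∈ Mach j, z i) ∧
  (∀ h, z h + (∑ k, w k h * (1 - z h)) + (∑ k, w h k * z k) ≤ 1 + θ)

/-- A valid assignment of heavy jobs. -/
def IsValid {M JH : Type*} (Mach : JH → Finset M) (f : JH → M) : Prop :=
  ∀ j, f j ∈ Mach j

/-- `f` is `δ`-good: the light loads can be fractionally assigned (each `w h k` split between
`h` and `k`, with `s h k` placed on `h` and the rest on `k`) so that every machine receives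
total load (including 1 for a heavy job, if assigned one) at most `2 - δ`. -/
def IsGood {M JH : Type*} [Fintype M] [DecidableEq M] [Fintype JH]
    (w : M → M → ℝ) (δ : ℝ) (f : JH → M) : Prop :=
  ∃ s : M → M → ℝ,
    (∀ h k, 0 ≤ s h k ∧ s h k ≤ w h k) ∧
    ∀ i : M,
      (if i ∈ Finset.univ.image f then (1 : ℝ) else 0) +
        (∑ k, s i k) + (∑ h, (w h i - s h i)) ≤ 2 - δ

/-- Deficiency of a machine `h`:
`φ h = 1 - z h - Σ_k (w k h (1 - z h) + w h k · z k)`. -/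
def deficiency {M : Type*} [Fintype M] (w : M → M → ℝ) (z : M → ℝ) (h : M) : ℝ :=
  1 - z h - ∑ k, (w k h * (1 - z h) + w h k * z k)

/-- Boundary of a set `S` of machines:
`bnd S = Σ_{h ∈ S} Σ_{k ∉ S} (w k h (1 - z h) + w h k · z k)`. -/
def bnd {M : Type*} [Fintype M] [DecidableEq M] (w : M → M → ℝ) (z : M → ℝ)
    (S : Finset M) : ℝ :=
  ∑ h ∈ S, ∑ k ∈ Sᶜ, (w k h * (1 - z h) + w h k * z k)

/-- The set `R` of red machines (w.r.t. parameter `δ₀`): those with `φ h + z h < δ₀`. -/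
def redSet {M : Type*} [Fintype M] (w : M → M → ℝ) (z : M → ℝ) (δ0 : ℝ) : Finset M :=
  Finset.univ.filter (fun h => deficiency w z h + z h < δ0)

/-- An edge `(h, k)` of the light load graph is dense if `w h k ≥ 1/(c₂ log q)`. -/
def denseEdge {M : Type*} (w : M → M → ℝ) (c2 q : ℝ) (h k : M) : Prop :=
  h ≠ k ∧ 0 < w h k ∧ 1 / (c2 * Real.log q) ≤ w h k

/-- A machine `h` is in-sparse if all its incoming edges in the light load graph are
sparse (i.e. it has no incoming dense edge); otherwise it is in-dense. -/
def inSparse {M : Type*} (w : M → M → ℝ) (c2 q : ℝ) (h : M) : Prop :=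
  ∀ k, ¬ denseEdge w c2 q k h

/-- A machine `h` is out-dense if `Σ_{k : (h,k) dense} z k ≥ 1/c₃`; otherwise out-sparse. -/
def outSparse {M : Type*} [Fintype M] (w : M → M → ℝ) (z : M → ℝ) (c2 c3 q : ℝ)
    (h : M) : Prop :=
  ∑ k ∈ Finset.univ.filter (fun k => denseEdge w c2 q h k), z k < 1 / c3

/-- Probability of an event when each `j` independently picks `i` with probability `μ j i`. -/
def assignProb {M JH : Type*} [Fintype M] [Fintype JH] [DecidableEq JH] (μ : JH → M → ℝ)
    (E : (JH → M) → Prop) : ℝ :=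
  ∑ g : JH → M, (∏ j, μ j (g j)) * (if E g then 1 else 0)

section AssignProb

variable {M JH : Type*} [Fintype M] [Fintype JH] [DecidableEq JH]

lemma sum_prod_mul_prod (μ F : JH → M → ℝ) :
    ∑ g : JH → M, (∏ j, μ j (g j)) * ∏ j, F j (g j) = ∏ j, ∑ i, μ j i * F j i := by
  rw [Fintype.prod_sum]
  exact Finset.sum_congr rfl fun g _ => Finset.prod_mul_distrib.symm

lemma assignProb_nonneg {μ : JH → M → ℝ} (hμ : ∀ j i, 0 ≤ μ j i) (E : (JH → M) → Prop) :
    0 ≤ assignProb μ E :=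
  Finset.sum_nonneg fun g _ =>
    mul_nonneg (Finset.prod_nonneg fun j _ => hμ j _) (by split_ifs <;> norm_num)

/-- Markov's inequality for a product of functions of the individual choices. -/
lemma mul_assignProb_le {μ : JH → M → ℝ} (hμ : ∀ j i, 0 ≤ μ j i) {F : JH → M → ℝ}
    (hF : ∀ j i, 0 ≤ F j i) (c : ℝ) (E : (JH → M) → Prop)
    (hE : ∀ g, (∀ j, μ j (g j) ≠ 0) → E g → c ≤ ∏ j, F j (g j)) :
    c * assignProb μ E ≤ ∏ j, ∑ i, μ j i * F j i := by
  rw [← sum_prod_mul_prod, assignProb, Finset.mul_sum]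
  refine Finset.sum_le_sum fun g _ => ?_
  have hp : 0 ≤ ∏ j, F j (g j) := Finset.prod_nonneg fun j _ => hF j _
  by_cases h0 : ∀ j, μ j (g j) ≠ 0
  · have hw : 0 ≤ ∏ j, μ j (g j) := Finset.prod_nonneg fun j _ => hμ j _
    by_cases h1 : E g
    · have := mul_le_mul_of_nonneg_left (hE g h0 h1) hw
      simp only [h1, if_true]
      linarith
    · simp only [h1, if_false, mul_zero]
      positivity
  · push Not at h0
    obtain ⟨j, hj⟩ := h0
    rw [Finset.prod_eq_zero (Finset.mem_univ j) hj]
    simp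

lemma assignProb_mono {μ : JH → M → ℝ} (hμ : ∀ j i, 0 ≤ μ j i) {E E' : (JH → M) → Prop}
    (h : ∀ g, E g → E' g) : assignProb μ E ≤ assignProb μ E' := by
  refine Finset.sum_le_sum fun g _ =>
    mul_le_mul_of_nonneg_left ?_ (Finset.prod_nonneg fun j _ => hμ j _)
  by_cases h1 : E g
  · simp [h1, h g h1]
  · simp only [h1, if_false]
    split_ifs <;> norm_num

lemma assignProb_apply_eq {μ : JH → M → ℝ} (hμ1 : ∀ j, ∑ i, μ j i = 1) (j : JH) (i : M) :
    assignProb μ (fun g => g j = i) = μ j i := by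
  have h := sum_prod_mul_prod μ (fun j' i' => if j' = j then (if i' = i then 1 else 0) else 1)
  have hl : ∀ g : JH → M,
      (∏ j', if j' = j then (if g j' = i then (1 : ℝ) else 0) else 1)
        = if g j = i then 1 else 0 := by
    intro g
    rw [Finset.prod_ite_eq']
    simp
  have hr : ∀ j', (∑ i', μ j' i' * (if j' = j then (if i' = i then (1 : ℝ) else 0) else 1))
      = if j' = j then μ j' i else 1 := by
    intro j'
    by_cases hj : j' = j
    · simp [hj]
    · simp [hj, hμ1]
  simp only [hl, hr] at h
  rw [Finset.prod_ite_eq'] at h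
  simpa [assignProb] using h

variable [DecidableEq M]

lemma le_assignProb_mem_image {μ : JH → M → ℝ} (hμ : ∀ j i, 0 ≤ μ j i)
    (hμ1 : ∀ j, ∑ i, μ j i = 1) (j : JH) (i : M) :
    μ j i ≤ assignProb μ (fun g => i ∈ Finset.univ.image g) := by
  rw [← assignProb_apply_eq hμ1 j i]
  exact assignProb_mono hμ fun g hg => Finset.mem_image.2 ⟨j, Finset.mem_univ _, hg⟩

lemma assignProb_mem_image_le {μ : JH → M → ℝ} (hμ : ∀ j i, 0 ≤ μ j i)
    (hμ1 : ∀ j, ∑ i, μ j i = 1) (i : M) :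
    assignProb μ (fun g => i ∈ Finset.univ.image g) ≤ ∑ j, μ j i := by
  have : ∑ j, μ j i = ∑ j, assignProb μ (fun g => g j = i) :=
    Finset.sum_congr rfl fun j _ => (assignProb_apply_eq hμ1 j i).symm
  rw [this]
  unfold assignProb
  rw [Finset.sum_comm]
  refine Finset.sum_le_sum fun g _ => ?_
  rw [← Finset.mul_sum]
  refine mul_le_mul_of_nonneg_left ?_ (Finset.prod_nonneg fun j _ => hμ j _)
  by_cases h : i ∈ Finset.univ.image g
  · obtain ⟨j, hj, hji⟩ := Finset.mem_image.1 h
    rw [if_pos h]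
    refine le_trans ?_ (Finset.single_le_sum (fun j _ => ?_) hj)
    · simp [hji]
    · split_ifs <;> norm_num
  · rw [if_neg h]
    exact Finset.sum_nonneg fun j _ => by split_ifs <;> norm_num

/-- If the supports of the choices are disjoint, the events `i ∈ X` are negatively correlated. -/
lemma assignProb_subset_image_le {μ : JH → M → ℝ} (hμ : ∀ j i, 0 ≤ μ j i)
    (hμ1 : ∀ j, ∑ i, μ j i = 1) (hdisj : ∀ j j' i, μ j i ≠ 0 → μ j' i ≠ 0 → j = j')
    (T : Finset M) :
    assignProb μ (fun g => T ⊆ Finset.univ.image g)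
      ≤ ∏ i ∈ T, assignProb μ (fun g => i ∈ Finset.univ.image g) := by
  by_cases hT : ∀ i ∈ T, ∃ j, μ j i ≠ 0
  · set S : JH → Finset M := fun j => T.filter (fun i => μ j i ≠ 0) with hS
    have hTS : T = Finset.univ.biUnion S := by
      ext i
      simp only [hS, Finset.mem_biUnion, Finset.mem_univ, true_and, Finset.mem_filter]
      exact ⟨fun hi => (hT i hi).imp fun j hj => ⟨hi, hj⟩, fun ⟨j, hi, _⟩ => hi⟩
    have hSd : (↑(Finset.univ : Finset JH) : Set JH).PairwiseDisjoint S := by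
      intro j _ j' _ hjj
      refine Finset.disjoint_left.2 fun i hi hi' => hjj ?_
      exact hdisj j j' i (Finset.mem_filter.1 hi).2 (Finset.mem_filter.1 hi').2
    have key := mul_assignProb_le hμ (F := fun j i => if S j ⊆ {i} then 1 else 0)
      (fun j i => by split_ifs <;> norm_num) 1 (fun g => T ⊆ Finset.univ.image g) (by
        intro g hg hTg
        refine le_of_eq (Finset.prod_eq_one fun j _ => ?_).symm
        refine if_pos fun i hi => ?_
        obtain ⟨hiT, hji⟩ := Finset.mem_filter.1 hi
        obtain ⟨j', -, hj'⟩ := Finset.mem_image.1 (hTg hiT)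
        have := hdisj j j' i hji (hj' ▸ hg j')
        subst this
        exact Finset.mem_singleton.2 hj'.symm)
    rw [one_mul] at key
    refine key.trans ?_
    conv_rhs => rw [hTS]
    rw [Finset.prod_biUnion hSd]
    refine Finset.prod_le_prod
      (fun j _ => Finset.sum_nonneg fun i _ =>
        mul_nonneg (hμ j i) (by split_ifs <;> norm_num)) fun j _ => ?_
    refine le_trans ?_ (Finset.prod_le_prod (fun i _ => hμ j i)
      fun i _ => le_assignProb_mem_image hμ hμ1 j i)
    rcases (S j).eq_empty_or_nonempty with h0 | ⟨i₀, hi₀⟩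
    · simp [h0, hμ1]
    · by_cases h1 : S j = {i₀}
      · simp [h1, Finset.sum_ite_eq]
      · refine le_trans (le_of_eq (Finset.sum_eq_zero fun i _ => ?_))
          (Finset.prod_nonneg fun i _ => hμ j i)
        rw [if_neg, mul_zero]
        intro hs
        have hi : i₀ = i := Finset.mem_singleton.1 (hs hi₀)
        subst hi
        exact h1 (Finset.Subset.antisymm hs (Finset.singleton_subset_iff.2 hi₀))
  · push Not at hT
    obtain ⟨i, hi, hz⟩ := hT
    have h0 : assignProb μ (fun g => T ⊆ Finset.univ.image g) ≤ ∑ j, μ j i :=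
      (assignProb_mono hμ fun g hg => hg hi).trans (assignProb_mem_image_le hμ hμ1 i)
    rw [Finset.sum_eq_zero fun j _ => hz j] at h0
    exact h0.trans (Finset.prod_nonneg fun i _ => assignProb_nonneg hμ _)

lemma exp_mul_sub_one_le {t a B : ℝ} (hB : 0 < B) (ha : 0 ≤ a) (haB : a ≤ B) :
    Real.exp (t * a) - 1 ≤ a / B * (Real.exp (t * B) - 1) := by
  have h := convexOn_exp.2 (Set.mem_univ (0 : ℝ)) (Set.mem_univ (t * B))
    (show 0 ≤ 1 - a / B by rw [sub_nonneg, div_le_one hB]; exact haB)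
    (show 0 ≤ a / B by positivity) (by ring)
  have e : a / B * (t * B) = t * a := by field_simp
  simp only [smul_eq_mul, mul_zero, zero_add, e, Real.exp_zero, mul_one] at h
  linarith

/-- Chernoff bound for the total weight of the set of chosen elements. -/
lemma assignProb_lt_sum_image_le {μ : JH → M → ℝ} (hμ : ∀ j i, 0 ≤ μ j i)
    (hμ1 : ∀ j, ∑ i, μ j i = 1) {z : M → ℝ} {C : ℝ} (hC : 0 ≤ C)
    (hz : ∀ i, ∑ j, μ j i ≤ C * z i) {a : M → ℝ} (ha : ∀ i, 0 ≤ a i) {B m t : ℝ}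
    (hB : 0 < B) (haB : ∀ i, z i ≠ 0 → a i ≤ B) (ht : 0 ≤ t)
    (hm : ∑ i, z i * a i ≤ m) (θ : ℝ) (E : (JH → M) → Prop)
    (hE : ∀ g, E g → θ < ∑ k ∈ Finset.univ.image g, a k) :
    assignProb μ E ≤ Real.exp (C * (m / B) * (Real.exp (t * B) - 1) - t * θ) := by
  have key := mul_assignProb_le hμ (F := fun _ i => Real.exp (t * a i))
    (fun _ i => (Real.exp_pos _).le) (Real.exp (t * θ)) E (by
      intro g _ hg
      rw [← Real.exp_sum, Real.exp_le_exp, ← Finset.mul_sum]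
      refine mul_le_mul_of_nonneg_left ((hE g hg).le.trans ?_) ht
      exact Finset.sum_image_le_of_nonneg fun u _ => ha u)
  have hj : ∏ j, ∑ i, μ j i * Real.exp (t * a i)
      ≤ Real.exp (∑ j, ∑ i, μ j i * (Real.exp (t * a i) - 1)) := by
    rw [Real.exp_sum]
    refine Finset.prod_le_prod
      (fun j _ => Finset.sum_nonneg fun i _ => mul_nonneg (hμ j i) (Real.exp_pos _).le)
      fun j _ => ?_
    have : ∑ i, μ j i * Real.exp (t * a i) = ∑ i, μ j i * (Real.exp (t * a i) - 1) + 1 := by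
      simp only [mul_sub, mul_one, Finset.sum_sub_distrib, hμ1 j, sub_add_cancel]
    rw [this]
    exact Real.add_one_le_exp _
  have hK : 0 ≤ Real.exp (t * B) - 1 := by
    have := Real.one_le_exp (mul_nonneg ht hB.le)
    linarith
  have hs : ∑ j, ∑ i, μ j i * (Real.exp (t * a i) - 1)
      ≤ C * (m / B) * (Real.exp (t * B) - 1) := by
    rw [Finset.sum_comm]
    calc ∑ i, ∑ j, μ j i * (Real.exp (t * a i) - 1)
        ≤ ∑ i, z i * a i * (C / B * (Real.exp (t * B) - 1)) := by
          refine Finset.sum_le_sum fun i _ => ?_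
          rw [← Finset.sum_mul]
          have h1 : 0 ≤ Real.exp (t * a i) - 1 := by
            have := Real.one_le_exp (mul_nonneg ht (ha i))
            linarith
          have h2 := mul_le_mul_of_nonneg_right (hz i) h1
          by_cases hzi : z i = 0
          · simpa [hzi] using h2
          · have h3 : 0 ≤ C * z i := (Finset.sum_nonneg fun j _ => hμ j i).trans (hz i)
            have h4 := mul_le_mul_of_nonneg_left
              (exp_mul_sub_one_le (t := t) hB (ha i) (haB i hzi)) h3
            refine h2.trans (h4.trans (le_of_eq ?_))
            ring
      _ = (∑ i, z i * a i) * (C / B * (Real.exp (t * B) - 1)) := by rw [Finset.sum_mul]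
      _ ≤ m * (C / B * (Real.exp (t * B) - 1)) :=
          mul_le_mul_of_nonneg_right hm (by positivity)
      _ = _ := by ring
  have h5 := key.trans (hj.trans (Real.exp_le_exp.2 hs))
  rw [Real.exp_sub, le_div_iff₀ (Real.exp_pos _)]
  linarith

end AssignProb

lemma IsPQCanonical.row_col_le {M JH : Type*} [Fintype M] {Mach : JH → Finset M}
    {w : M → M → ℝ} {z : M → ℝ} {p q : ℝ} (hI : IsPQCanonical Mach w z p q 0) (h : M) :
    z h + ∑ k, (w k h * (1 - z h) + w h k * z k) ≤ 1 := by
  have := hI.2.2.2.2.2.2.2.2 h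
  rw [Finset.sum_add_distrib]
  linarith

lemma IsPQCanonical.sum_mul_le_one {M JH : Type*} [Fintype M] {Mach : JH → Finset M}
    {w : M → M → ℝ} {z : M → ℝ} {p q : ℝ} (hI : IsPQCanonical Mach w z p q 0) (h : M) :
    ∑ k, w h k * z k ≤ 1 := by
  have h1 := hI.row_col_le h
  obtain ⟨⟨-, hw, -, -, hz, -⟩, -⟩ := hI
  have h2 : ∑ k, w h k * z k ≤ ∑ k, (w k h * (1 - z h) + w h k * z k) :=
    Finset.sum_le_sum fun k _ => by
      have := mul_nonneg (hw k h) (show 0 ≤ 1 - z h by linarith [(hz h).2])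
      linarith
  linarith [(hz h).1]

lemma IsPQCanonical.weight_le_one {M JH : Type*} [Fintype M] {Mach : JH → Finset M}
    {w : M → M → ℝ} {z : M → ℝ} {p q : ℝ} (hI : IsPQCanonical Mach w z p q 0) (h k : M) :
    w h k ≤ 1 := by
  have h1 := hI.row_col_le k
  obtain ⟨⟨-, hw, -, -, hz, -⟩, -⟩ := hI
  have hk : 0 < 1 - z k := by linarith [(hz k).2]
  have h2 : w h k * (1 - z k) + w k h * z h ≤ ∑ l, (w l k * (1 - z k) + w k l * z l) :=
    Finset.single_le_sum (f := fun l => w l k * (1 - z k) + w k l * z l)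
      (fun l _ => add_nonneg (mul_nonneg (hw l k) hk.le) (mul_nonneg (hw k l) (hz l).1))
      (Finset.mem_univ h)
  have h3 := mul_nonneg (hw k h) (hz h).1
  have h4 : w h k * (1 - z k) ≤ 1 * (1 - z k) := by linarith
  exact le_of_mul_le_mul_right h4 hk

/-- Red machines have small heavy load. -/
lemma IsPQCanonical.lt_of_mem_redSet {M JH : Type*} [Fintype M] {Mach : JH → Finset M}
    {w : M → M → ℝ} {z : M → ℝ} {p q δ : ℝ} (hI : IsPQCanonical Mach w z p q 0) {h : M}
    (hh : h ∈ redSet w z δ) : z h < δ := by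
  have h1 := hI.row_col_le h
  have h2 := (Finset.mem_filter.1 hh).2
  unfold deficiency at h2
  linarith

/-- **Probability bounds for the bad events.** With `c₁ = 12`, `c₂ = 300`, `c₃ = 200`,
`δ₀ = (34 c₂ c₃ log q)⁻¹`: for `q` sufficiently large and any `(q,q,0)`-canonical
instance with subsets `M'_j ⊆ M_j` of `z`-mass at least `0.49·z(M_j)`, the random
assignment choosing `f j = i ∈ M'_j` independently with probability `z i / z(M'_j)`
satisfies: writing `X = f(J_H)` and `p i = Pr[i ∈ X]`, we have `p i ≤ 11 z i`, and
(1) `Pr[A_h] ≤ q^{-c₁}`, (2) `Pr[T ⊆ X] ≤ ∏_{i∈T} p i`, (3) `Pr[C_h] ≤ q^{-c₂}`,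
(4) `Pr[D_h] ≤ q^{-c₂}`. -/
theorem bad_event_probabilities :
    ∃ q1 : ℝ, ∀ q : ℝ, q1 ≤ q →
      ∀ (M JH : Type) [Fintype M] [DecidableEq M] [Fintype JH] [DecidableEq JH]
        (Mach Mach' : JH → Finset M) (w : M → M → ℝ) (z : M → ℝ),
        IsPQCanonical Mach w z q q 0 →
        (∀ j, Mach' j ⊆ Mach j) →
        (∀ j, 0.49 * ∑ i ∈ Mach j, z i ≤ ∑ i ∈ Mach' j, z i) →
        letI c1 : ℝ := 12
        letI c2 : ℝ := 300
        letI c3 : ℝ := 200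
        letI δ0 : ℝ := (34 * c2 * c3 * Real.log q)⁻¹
        letI μ : JH → M → ℝ := fun j i =>
          if i ∈ Mach' j then z i / ∑ i' ∈ Mach' j, z i' else 0
        letI Pr : ((JH → M) → Prop) → ℝ := fun E =>
          ∑ g : JH → M, (∏ j, μ j (g j)) * (if E g then 1 else 0)
        letI X : (JH → M) → Finset M := fun g => Finset.univ.image g
        letI R : Finset M := redSet w z δ0
        letI pp : M → ℝ := fun i => Pr (fun g => i ∈ X g)
        (∀ i : M, pp i ≤ 11 * z i) ∧
        (∀ h : M,
          Pr (fun g => c1 * Real.log q < ∑ k ∈ X g ∩ R, w h k) ≤ q ^ (-c1)) ∧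
        (∀ T : Finset M, Pr (fun g => T ⊆ X g) ≤ ∏ i ∈ T, pp i) ∧
        (∀ h : M,
          Pr (fun g => 17 * c2 * Real.log q <
              (((X g ∩ R).filter (fun k => denseEdge w c2 q h k)).card : ℝ))
            ≤ q ^ (-c2)) ∧
        (∀ h : M, inSparse w c2 q h →
          Pr (fun g => 0.1 < ∑ k ∈ X g ∩ R, (w k h * (1 - z h) + w h k * z k))
            ≤ q ^ (-c2)) := by
  refine ⟨Real.exp 1000000, ?_⟩
  intro q hq M JH _ _ _ _ Mach Mach' w z hI hsub hmass
  let c1 : ℝ := 12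
  let c2 : ℝ := 300
  let c3 : ℝ := 200
  let δ0 : ℝ := (34 * c2 * c3 * Real.log q)⁻¹
  let μ : JH → M → ℝ := fun j i =>
    if i ∈ Mach' j then z i / ∑ i' ∈ Mach' j, z i' else 0
  let X : (JH → M) → Finset M := fun g => Finset.univ.image g
  let R : Finset M := redSet w z δ0
  change (∀ i : M, assignProb μ (fun g => i ∈ X g) ≤ 11 * z i) ∧
    (∀ h : M, assignProb μ (fun g => c1 * Real.log q < ∑ k ∈ X g ∩ R, w h k) ≤ q ^ (-c1)) ∧
    (∀ T : Finset M, assignProb μ (fun g => T ⊆ X g)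
      ≤ ∏ i ∈ T, assignProb μ (fun g => i ∈ X g)) ∧
    (∀ h : M, assignProb μ (fun g => 17 * c2 * Real.log q <
        (((X g ∩ R).filter (fun k => denseEdge w c2 q h k)).card : ℝ)) ≤ q ^ (-c2)) ∧
    (∀ h : M, inSparse w c2 q h → assignProb μ (fun g =>
        0.1 < ∑ k ∈ X g ∩ R, (w k h * (1 - z h) + w h k * z k)) ≤ q ^ (-c2))
  have hq0 : 0 < q := (Real.exp_pos _).trans_le hq
  have hlog : 1000000 ≤ Real.log q := (Real.le_log_iff_exp_le hq0).2 hq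
  have hlog0 : 0 < Real.log q := by linarith
  have hrow := hI.row_col_le
  have hrow' := hI.sum_mul_le_one
  have hw1 := hI.weight_le_one
  have hred : ∀ {k}, k ∈ R → z k < δ0 := fun hk => hI.lt_of_mem_redSet hk
  obtain ⟨⟨hdM, hw, hw0, hwd, hz, hzM⟩, -, -, -, -, -, -, hjob, -⟩ := hI
  have hS : ∀ j, 0.098 ≤ ∑ i ∈ Mach' j, z i := fun j => by
    have h1 := hmass j
    have h2 := hjob j
    norm_num at h1 h2 ⊢
    linarith
  have hS0 : ∀ j, 0 < ∑ i ∈ Mach' j, z i := fun j => lt_of_lt_of_le (by norm_num) (hS j)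
  have hμ : ∀ j i, 0 ≤ μ j i := by
    intro j i
    simp only [μ]
    split_ifs
    · exact div_nonneg (hz i).1 (hS0 j).le
    · exact le_rfl
  have hμ1 : ∀ j, ∑ i, μ j i = 1 := by
    intro j
    simp only [μ]
    rw [← Finset.sum_filter, Finset.filter_mem_eq_inter, Finset.univ_inter, ← Finset.sum_div]
    exact div_self (hS0 j).ne'
  have hmem : ∀ {j i}, μ j i ≠ 0 → i ∈ Mach' j := by
    intro j i h
    by_contra hc
    exact h (if_neg hc)
  have hdisj : ∀ j j' i, μ j i ≠ 0 → μ j' i ≠ 0 → j = j' := by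
    intro j j' i h h'
    by_contra hne
    exact Finset.disjoint_left.1 (hdM hne) (hsub j (hmem h)) (hsub j' (hmem h'))
  have hsum : ∀ i, ∑ j, μ j i ≤ 11 * z i := by
    intro i
    by_cases hi : ∃ j, μ j i ≠ 0
    · obtain ⟨j, hj⟩ := hi
      rw [Finset.sum_eq_single j (fun j' _ hne => by
        by_contra hc
        exact hne (hdisj j' j i hc hj)) (fun h => absurd (Finset.mem_univ j) h)]
      simp only [μ, if_pos (hmem hj)]
      rw [div_le_iff₀ (hS0 j)]
      have h1 := hS j
      norm_num at h1
      nlinarith [(hz i).1]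
    · push Not at hi
      rw [Finset.sum_eq_zero fun j _ => hi j]
      linarith [(hz i).1]
  have hinter : ∀ (a : M → ℝ) (g : JH → M),
      ∑ k ∈ X g ∩ R, a k = ∑ k ∈ Finset.univ.image g, if k ∈ R then a k else 0 := by
    intro a g
    rw [← Finset.sum_filter, Finset.filter_mem_eq_inter]
  have hexp3 : Real.exp 1 < 3 := by linarith [Real.exp_one_lt_d9]
  have hexp : ∀ n : ℕ, Real.exp n ≤ 3 ^ n := by
    intro n
    rw [← Real.exp_one_pow]
    exact pow_le_pow_left₀ (Real.exp_pos _).le hexp3.le n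
  have hpow : ∀ c : ℝ, q ^ (-c) = Real.exp (-(c * Real.log q)) := by
    intro c
    rw [Real.rpow_def_of_pos hq0]
    congr 1
    ring
  refine ⟨?_, ?_, ?_, ?_, ?_⟩
  · intro i
    exact (assignProb_mem_image_le hμ hμ1 i).trans (hsum i)
  · intro h
    rw [hpow]
    refine (assignProb_lt_sum_image_le hμ hμ1 (by norm_num) hsum
      (a := fun k => if k ∈ R then w h k else 0) (B := 1) (m := 1) (t := 2) ?_ one_pos ?_
      (by norm_num) ?_ (c1 * Real.log q) _ ?_).trans (Real.exp_le_exp.2 ?_)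
    · intro i
      split_ifs
      · exact hw h i
      · exact le_rfl
    · intro i _
      split_ifs
      · exact hw1 h i
      · exact zero_le_one
    · refine le_trans (Finset.sum_le_sum fun i _ => ?_) (hrow' h)
      split_ifs
      · exact (mul_comm _ _).le
      · rw [mul_zero]
        exact mul_nonneg (hw h i) (hz i).1
    · intro g hg
      rwa [hinter] at hg
    · have := hexp 2
      norm_num at this
      simp only [c1]
      norm_num
      linarith
  · intro T
    exact assignProb_subset_image_le hμ hμ1 hdisj T
  · intro h
    rw [hpow]
    have hL : 0 < c2 * Real.log q := by
      simp only [c2]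
      positivity
    refine (assignProb_lt_sum_image_le hμ hμ1 (by norm_num) hsum
      (a := fun k => if denseEdge w c2 q h k then 1 else 0) (B := 1) (m := c2 * Real.log q)
      (t := 2 / 5) ?_ one_pos ?_ (by norm_num) ?_ (17 * c2 * Real.log q) _ ?_).trans
      (Real.exp_le_exp.2 ?_)
    · intro i
      split_ifs <;> norm_num
    · intro i _
      split_ifs <;> norm_num
    · have h1 : ∑ k, c2 * Real.log q * (w h k * z k) ≤ c2 * Real.log q := by
        rw [← Finset.mul_sum]
        exact mul_le_of_le_one_right hL.le (hrow' h)
      refine le_trans (Finset.sum_le_sum fun i _ => ?_) h1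
      split_ifs with hd
      · have h2 := hd.2.2
        rw [div_le_iff₀ hL] at h2
        have h3 := mul_le_mul_of_nonneg_right h2 (hz i).1
        linarith
      · rw [mul_zero]
        exact mul_nonneg hL.le (mul_nonneg (hw h i) (hz i).1)
    · intro g hg
      refine hg.trans_le ?_
      rw [Finset.card_filter]
      push_cast
      refine Finset.sum_le_sum_of_subset_of_nonneg Finset.inter_subset_left fun i _ _ => ?_
      split_ifs <;> norm_num
    · have he : Real.exp (2 / 5) ≤ 3 / 2 := by
        have h5 : Real.exp (2 / 5) ^ 5 = Real.exp 1 ^ 2 := by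
          rw [← Real.exp_nat_mul, ← Real.exp_nat_mul]
          norm_num
        refine le_of_pow_le_pow_left₀ (n := 5) (by norm_num) (by norm_num) ?_
        rw [h5]
        have := Real.exp_one_lt_d9
        nlinarith [Real.exp_pos 1]
      rw [mul_one, div_one]
      nlinarith
  · intro h hsp
    rw [hpow]
    set L := c2 * Real.log q with hLdef
    have hL : 300000000 ≤ L := by
      simp only [hLdef, c2]
      linarith
    have hL0 : 0 < L := by linarith
    have hδ : δ0 = 1 / (6800 * L) := by
      simp only [δ0, hLdef, c2, c3]
      rw [one_div]
      congr 1
      ring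
    have hδ0 : 0 < δ0 := by
      rw [hδ]
      positivity
    have hzh : 0 ≤ 1 - z h := by linarith [(hz h).2]
    have hterm : ∀ k, 0 ≤ w k h * (1 - z h) + w h k * z k := fun k =>
      add_nonneg (mul_nonneg (hw k h) hzh) (mul_nonneg (hw h k) (hz k).1)
    refine (assignProb_lt_sum_image_le hμ hμ1 (by norm_num) hsum
      (a := fun k => if k ∈ R then w k h * (1 - z h) + w h k * z k else 0)
      (B := 12 / (11 * L)) (m := δ0) (t := 11 * L) ?_ (by positivity) ?_
      (by positivity) ?_ 0.1 _ ?_).trans (Real.exp_le_exp.2 ?_)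
    · intro i
      split_ifs
      · exact hterm i
      · exact le_rfl
    · intro i hi
      have hB : 0 < 12 / (11 * L) := by positivity
      split_ifs with hR
      · by_cases hih : i = h
        · subst hih
          rw [hwd i (lt_of_le_of_ne (hz i).1 (Ne.symm hi))]
          simpa using hB.le
        · have h1 : w i h ≤ 1 / L := by
            by_contra hc
            push Not at hc
            exact hsp i ⟨hih, lt_trans (by positivity) hc, hc.le⟩
          have h2 : w i h * (1 - z h) ≤ w i h :=
            mul_le_of_le_one_right (hw i h) (by linarith [(hz h).1])
          have h3 : w h i * z i ≤ z i := mul_le_of_le_one_left (hz i).1 (hw1 h i)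
          have h4 := hred hR
          have h5 : 1 / L + δ0 ≤ 12 / (11 * L) := by
            rw [hδ, div_add_div _ _ hL0.ne' (by positivity),
              div_le_div_iff₀ (by positivity) (by positivity)]
            nlinarith [mul_pos hL0 hL0]
          linarith
      · exact hB.le
    · have h1 : ∑ k, δ0 * (w k h * (1 - z h) + w h k * z k) ≤ δ0 := by
        rw [← Finset.mul_sum]
        exact mul_le_of_le_one_right hδ0.le (by linarith [hrow h, (hz h).1])
      refine le_trans (Finset.sum_le_sum fun i _ => ?_) h1
      split_ifs with hR
      · exact mul_le_mul_of_nonneg_right (hred hR).le (hterm i)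
      · rw [mul_zero]
        exact mul_nonneg hδ0.le (hterm i)
    · intro g hg
      rwa [hinter] at hg
    · have e1 : 11 * L * (12 / (11 * L)) = 12 := by field_simp
      have e2 : δ0 / (12 / (11 * L)) = 11 / 81600 := by
        rw [hδ]
        field_simp
        norm_num
      have h12 := hexp 12
      norm_num at h12
      rw [e1, e2]
      norm_num
      linarith
end
end

section
/- Let I be a (q,q,0)-canonical instance, let δ_0 ≤ 0.001 (red machines defined with parameter δ_0), and suppose a set of red edges of the light load graph G_w is given such that every machine has at most one incoming red edge and both endpoints of every red edge are red. Then there exist subsets M'_j ⊆ M_j for each heavy job j with Σ_{i∈M'_j} z_i ≥ 0.49·Σ_{i∈M_j} z_i such that the subgraph formed by the red edges on the vertex set ∪_{j∈J_H} M'_j contains no cycle. -/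
open Finset

noncomputable section

open scoped Classical

/-- Two fixed-point-free involutions have a common proper 2-coloring: the union of two perfect
matchings is bipartite. -/
theorem exists_coloring_of_fixedPointFree {V : Type*} (σ τ : Equiv.Perm V)
    (hσ : σ * σ = 1) (hτ : τ * τ = 1) (hσ0 : ∀ x, σ x ≠ x) (hτ0 : ∀ x, τ x ≠ x) :
    ∃ c : V → Bool, (∀ x, c (σ x) ≠ c x) ∧ ∀ x, c (τ x) ≠ c x := by
  set g : Equiv.Perm V := σ * τ with hg
  have hσi : σ⁻¹ = σ := inv_eq_of_mul_eq_one_left hσ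
  have hτi : τ⁻¹ = τ := inv_eq_of_mul_eq_one_left hτ
  have hconj : ∀ n : ℤ, σ * g ^ n = g ^ (-n) * σ := by
    intro n
    have h1 : σ * g * σ⁻¹ = g⁻¹ := by
      rw [hg, mul_inv_rev, hσi, hτi, ← mul_assoc, hσ, one_mul]
    have h2 : σ * g ^ n * σ⁻¹ = g ^ (-n) := by
      rw [← conj_zpow, h1, inv_zpow, zpow_neg]
    rw [← h2, inv_mul_cancel_right]
  have hconj' : ∀ (n : ℤ) x, σ ((g ^ n) x) = (g ^ (-n)) (σ x) := fun n x => by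
    rw [← Equiv.Perm.mul_apply, hconj, Equiv.Perm.mul_apply]
  have hσσ : ∀ x, σ (σ x) = x := fun x => by
    rw [← Equiv.Perm.mul_apply, hσ, Equiv.Perm.one_apply]
  have hττ : ∀ x, τ (τ x) = x := fun x => by
    rw [← Equiv.Perm.mul_apply, hτ, Equiv.Perm.one_apply]
  have hτg : ∀ x, τ x = σ (g x) := fun x => by
    rw [hg, Equiv.Perm.mul_apply, hσσ]
  have hsep : ∀ x, ¬ g.SameCycle x (σ x) := by
    rintro x ⟨n, hn⟩
    obtain ⟨m, rfl | rfl⟩ := Int.even_or_odd' n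
    · apply hσ0 ((g ^ m) x)
      rw [hconj', ← hn, ← Equiv.Perm.mul_apply, ← zpow_add]
      congr 2
      ring
    · apply hτ0 ((g ^ m) x)
      have h1 : g ((g ^ m) x) = (g ^ (1 + m)) x := by
        rw [zpow_one_add]
        rfl
      rw [hτg, h1, hconj', ← hn, ← Equiv.Perm.mul_apply, ← zpow_add]
      congr 2
      ring
  let s := Equiv.Perm.SameCycle.setoid g
  let _ : LinearOrder (Quotient s) := IsWellOrder.linearOrder WellOrderingRel
  let C : V → Quotient s := Quotient.mk s
  have hC : ∀ x y, C x = C y ↔ g.SameCycle x y := fun x y => Quotient.eq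
  refine ⟨fun x => decide (C x < C (σ x)), fun x => ?_, fun x => ?_⟩
  · have hne : C x ≠ C (σ x) := fun h => hsep x ((hC _ _).1 h)
    rcases lt_or_gt_of_ne hne with h | h
    · simp [hσσ, h, h.le]
    · have h' : C (σ x) < C x := h
      simp [hσσ, h', h'.le]
  · have hne : C x ≠ C (σ x) := fun h => hsep x ((hC _ _).1 h)
    have h1 : C (τ x) = C (σ x) := (hC _ _).2 ⟨1, by
      rw [zpow_one, hg, Equiv.Perm.mul_apply, hττ]⟩
    have h2 : C (σ (τ x)) = C x := ((hC _ _).2 ⟨1, by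
      rw [zpow_one, hg, Equiv.Perm.mul_apply]⟩).symm
    rcases lt_or_gt_of_ne hne with h | h
    · simp [h1, h2, h, h.le]
    · have h' : C (σ x) < C x := h
      simp [h1, h2, h', h'.le]

/-- A fixed-point-free involution and an arbitrary involution have a common 2-coloring, proper
away from the fixed points: the union of two matchings is bipartite. -/
theorem exists_coloring_of_involutive {V : Type*} {σ τ : V → V}
    (hσ : Function.Involutive σ) (hτ : Function.Involutive τ) (hσ0 : ∀ x, σ x ≠ x) :
    ∃ c : V → Bool, (∀ x, c (σ x) ≠ c x) ∧ ∀ x, τ x ≠ x → c (τ x) ≠ c x := by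
  let σ' : V × Bool → V × Bool := fun y => (σ y.1, y.2)
  let τ' : V × Bool → V × Bool := fun y => if τ y.1 = y.1 then (y.1, !y.2) else (τ y.1, y.2)
  have hσ' : Function.Involutive σ' := fun y => by simp [σ', hσ y.1]
  have hτ' : Function.Involutive τ' := by
    rintro ⟨x, b⟩
    by_cases h : τ x = x
    · simp [τ', h]
    · have h' : τ (τ x) ≠ τ x := by rw [hτ x]; exact Ne.symm h
      simp [τ', h, hτ x, Ne.symm h]
  obtain ⟨c, hc1, hc2⟩ := exists_coloring_of_fixedPointFree hσ'.toPerm hτ'.toPerm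
    (Equiv.ext fun y => hσ' y) (Equiv.ext fun y => hτ' y)
    (fun y h => hσ0 y.1 (congrArg Prod.fst h)) (by
      rintro ⟨x, b⟩ h
      have h' : τ' (x, b) = (x, b) := h
      by_cases hx : τ x = x
      · simp [τ', hx] at h'
      · simp [τ', hx] at h')
  refine ⟨fun x => c (x, false), fun x => hc1 (x, false), fun x hx => ?_⟩
  have := hc2 (x, false)
  simpa [τ', hx] using this

/-- Elements of a weighted finite set can be paired so that every set containing at most one
element of each pair has at most half of the weight, up to half of the largest weight. -/
theorem exists_pairing_sum_le {V : Type*} (z : V → ℝ) (n : ℕ) :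
    ∀ (A : Finset V) (m : ℝ), A.card = n → 0 ≤ m → (∀ x ∈ A, 0 ≤ z x) → (∀ x ∈ A, z x ≤ m) →
    ∃ τ : V → V, Function.Involutive τ ∧ (∀ x ∈ A, τ x ∈ A) ∧ (∀ x ∉ A, τ x = x) ∧
      ∀ c : V → Bool, (∀ x, τ x ≠ x → c (τ x) ≠ c x) →
        ∑ x ∈ A, (if c x then z x else 0) ≤ (∑ x ∈ A, z x + m) / 2 := by
  induction n using Nat.strong_induction_on with
  | _ n ih =>
    intro A m hA hm hz0 hzm
    rcases A.eq_empty_or_nonempty with rfl | hne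
    · exact ⟨id, fun _ => rfl, by simp, by simp, fun c _ => by simp; linarith⟩
    obtain ⟨a, ha, hamax⟩ := A.exists_max_image z hne
    rcases (A.erase a).eq_empty_or_nonempty with he | hne'
    · have hAa : A = {a} := by
        rw [← insert_erase ha, he, insert_empty_eq]
      refine ⟨id, fun _ => rfl, fun _ h => h, fun _ _ => rfl, fun c _ => ?_⟩
      have h0 := hz0 a ha
      have h1 := hzm a ha
      rw [hAa, sum_singleton, sum_singleton]
      split_ifs <;> linarith
    obtain ⟨b, hb, hbmax⟩ := (A.erase a).exists_max_image z hne'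
    have hba : b ≠ a := ne_of_mem_erase hb
    have hbA : b ∈ A := mem_of_mem_erase hb
    set B := (A.erase a).erase b with hB
    have hBA : ∀ x ∈ B, x ∈ A := fun x hx => mem_of_mem_erase (mem_of_mem_erase hx)
    have haB : a ∉ B := fun h => notMem_erase a A (mem_of_mem_erase h)
    have hbB : b ∉ B := notMem_erase b _
    have hcard : B.card < n := by
      rw [← hA]
      exact (card_erase_lt_of_mem hb).trans (card_erase_lt_of_mem ha)
    obtain ⟨τ, hτ, hτB, hτB', hsum⟩ := ih _ hcard B (z b) rfl (hz0 b hbA)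
      (fun x hx => hz0 x (hBA x hx)) (fun x hx => hbmax x (mem_of_mem_erase hx))
    have hτa : τ a = a := hτB' a haB
    have hτb : τ b = b := hτB' b hbB
    let τ' : V → V := fun x => if x = a then b else if x = b then a else τ x
    have hτ'a : τ' a = b := by simp [τ']
    have hτ'b : τ' b = a := by simp [τ', hba]
    have hτ' : ∀ x, x ≠ a → x ≠ b → τ' x = τ x := fun x h1 h2 => by simp [τ', h1, h2]
    have hAsum : ∀ f : V → ℝ, ∑ x ∈ A, f x = f a + (f b + ∑ x ∈ B, f x) := fun f => by
      rw [hB, add_sum_erase _ f hb, add_sum_erase _ f ha]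
    refine ⟨τ', fun x => ?_, fun x hx => ?_, fun x hx => ?_, fun c hc => ?_⟩
    · rcases eq_or_ne x a with rfl | h1
      · rw [hτ'a, hτ'b]
      rcases eq_or_ne x b with rfl | h2
      · rw [hτ'b, hτ'a]
      rw [hτ' x h1 h2, hτ', hτ x]
      · intro h
        exact h1 (by rw [← hτ x, h, hτa])
      · intro h
        exact h2 (by rw [← hτ x, h, hτb])
    · rcases eq_or_ne x a with rfl | h1
      · rwa [hτ'a]
      rcases eq_or_ne x b with rfl | h2
      · rwa [hτ'b]
      rw [hτ' x h1 h2]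
      exact hBA _ (hτB x (mem_erase.2 ⟨h2, mem_erase.2 ⟨h1, hx⟩⟩))
    · rw [hτ' x (fun h => hx (h ▸ ha)) (fun h => hx (h ▸ hbA))]
      exact hτB' x fun h => hx (hBA x h)
    · have h1 := hsum c fun x hx => by
        have hxa : x ≠ a := fun h => hx (h ▸ hτa)
        have hxb : x ≠ b := fun h => hx (h ▸ hτb)
        rw [← hτ' x hxa hxb] at hx ⊢
        exact hc x hx
      have h2 : c b ≠ c a := by
        have := hc a (by rwa [hτ'a])
        rwa [hτ'a] at this
      have h3 := hzm a ha
      have h4 := hamax b hbA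
      rw [hAsum, hAsum]
      cases hca : c a <;> cases hcb : c b
      · exact absurd (hcb.trans hca.symm) h2
      · simp only [Bool.false_eq_true, if_true, if_false]
        linarith
      · simp only [Bool.false_eq_true, if_true, if_false]
        linarith
      · exact absurd (hcb.trans hca.symm) h2

/-- Rounding: given two alternatives for each `q`, each of weight in `[0, m]` and charged to a
label, one alternative can be chosen for each `q` so that every label is charged at most half
of its total weight plus `m / 2`. -/
theorem exists_choice_sum_le {Q ι : Type*} [Fintype Q] (lab : Q × Bool → ι)
    (z : Q × Bool → ℝ) (m : ℝ) (hm : 0 ≤ m) (hz0 : ∀ x, 0 ≤ z x) (hz : ∀ x, z x ≤ m) :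
    ∃ b : Q → Bool, ∀ j,
      ∑ q ∈ univ.filter (fun q => lab (q, b q) = j), z (q, b q) ≤
        (∑ x ∈ univ.filter (fun x => lab x = j), z x + m) / 2 := by
  have hpair := fun j => exists_pairing_sum_le z _ (univ.filter (fun x => lab x = j)) m rfl hm
    (fun x _ => hz0 x) (fun x _ => hz x)
  choose t ht htmem htfix htsum using hpair
  have hlab : ∀ x, lab (t (lab x) x) = lab x := fun x => by
    simpa using htmem (lab x) x (by simp)
  obtain ⟨c, hc1, hc2⟩ := exists_coloring_of_involutive
    (σ := fun x : Q × Bool => (x.1, !x.2)) (τ := fun x => t (lab x) x)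
    (fun x => by simp) (fun x => by simp only [hlab]; exact ht _ x)
    (fun x h => by simpa using congrArg Prod.snd h)
  have hc : ∀ q b, c (q, b) = true ↔ b = c (q, true) := by
    intro q b
    have h1 := hc1 (q, true)
    cases b <;> cases h2 : c (q, true) <;> simp_all
  refine ⟨fun q => c (q, true), fun j => ?_⟩
  refine le_trans (le_of_eq ?_) (htsum j c fun x hx => ?_)
  · rw [← sum_filter]
    refine sum_bij (fun q _ => (q, c (q, true))) ?_ ?_ ?_ ?_
    · intro q hq
      simp only [mem_filter, mem_univ, true_and] at hq ⊢
      exact ⟨hq, (hc q _).2 rfl⟩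
    · intro q _ q' _ h
      exact congrArg Prod.fst h
    · rintro ⟨q, b⟩ hx
      simp only [mem_filter, mem_univ, true_and] at hx
      have hb := (hc q b).1 hx.2
      exact ⟨q, by simpa [← hb] using hx.1, by rw [← hb]⟩
    · intro q _
      rfl
  · by_cases hj : lab x = j
    · subst hj
      exact hc2 x hx
    · exact absurd (htfix j x (by simpa using hj)) hx

/-- In a graph whose edges join each vertex to its image under `p`, a cycle contains
a periodic orbit of `p`. -/
theorem exists_periodic_of_isCycle {V : Type*} {G : SimpleGraph V} {p : V → V}
    (hG : ∀ x y, G.Adj x y → p y = x ∨ p x = y) {v : V} {w : G.Walk v v} (hw : w.IsCycle) :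
    ∃ x n, 0 < n ∧ p^[n] x = x ∧ ∀ k, G.Adj (p (p^[k] x)) (p^[k] x) := by
  set S := w.support.tail.toFinset with hS
  set E := w.edges.toFinset with hE
  have hmemS : ∀ x, x ∈ S ↔ x ∈ w.support := by
    intro x
    rw [hS, List.mem_toFinset]
    exact ⟨List.mem_of_mem_tail, fun h => by
      rw [SimpleGraph.Walk.mem_support_iff] at h
      rcases h with rfl | h
      · exact SimpleGraph.Walk.end_mem_tail_support (SimpleGraph.Walk.IsCycle.not_nil hw)
      · exact h⟩
  have hcard : S.card = E.card := by
    rw [hS, hE, List.toFinset_card_of_nodup hw.support_nodup,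
      List.toFinset_card_of_nodup hw.edges_nodup]
    simp
  have hsub : E ⊆ S.image (fun x => s(p x, x)) := by
    intro e he
    induction e with
    | _ x y =>
      have he' : s(x, y) ∈ w.edges := by simpa [hE] using he
      have hx := (hmemS x).2 (w.fst_mem_support_of_mem_edges he')
      have hy := (hmemS y).2 (w.snd_mem_support_of_mem_edges he')
      rw [mem_image]
      rcases hG x y (w.adj_of_mem_edges he') with h | h
      · exact ⟨y, hy, by rw [h]⟩
      · exact ⟨x, hx, by rw [h, Sym2.eq_swap]⟩
  have heq : E = S.image (fun x => s(p x, x)) :=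
    eq_of_subset_of_card_le hsub (hcard ▸ card_image_le)
  have hedge : ∀ x ∈ S, s(p x, x) ∈ w.edges := fun x hx => by
    have : s(p x, x) ∈ E := heq ▸ mem_image_of_mem (fun x => s(p x, x)) hx
    simpa [hE] using this
  have hpS : ∀ x ∈ S, p x ∈ S := fun x hx =>
    (hmemS _).2 (w.fst_mem_support_of_mem_edges (hedge x hx))
  have hiter : ∀ k, p^[k] v ∈ S := by
    intro k
    induction k with
    | zero => exact (hmemS v).2 w.start_mem_support
    | succ k ih => rw [Function.iterate_succ_apply']; exact hpS _ ih
  obtain ⟨i, j, hij, h⟩ := Finite.exists_ne_map_eq_of_infinite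
    (fun k : ℕ => (⟨p^[k] v, hiter k⟩ : S))
  have h' : p^[i] v = p^[j] v := congrArg Subtype.val h
  wlog hlt : i < j generalizing i j
  · exact this j i hij.symm h.symm h'.symm (by omega)
  refine ⟨p^[i] v, j - i, by omega, ?_, fun k => ?_⟩
  · rw [← Function.iterate_add_apply, Nat.sub_add_cancel hlt.le, h']
  · rw [← Function.iterate_add_apply]
    exact w.adj_of_mem_edges (hedge _ (hiter _))

/-- For a map `p`, a family of disjoint pairs `{r, p r}` of non-fixed points such that
every orbit of a periodic non-fixed point contains one of the pairs. -/
theorem exists_pairs_of_periodic {V : Type*} (p : V → V) :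
    ∃ Q : Set V, (∀ r ∈ Q, p r ≠ r) ∧
      Function.Injective (fun x : Q × Bool => if x.2 then x.1.1 else p x.1.1) ∧
      ∀ x n, 0 < n → p^[n] x = x → p x ≠ x → ∃ k, p^[k] x ∈ Q := by
  let s : Setoid V :=
    { r := fun x y => (∃ n, p^[n] x = y) ∧ ∃ n, p^[n] y = x
      iseqv :=
        { refl := fun x => ⟨⟨0, rfl⟩, ⟨0, rfl⟩⟩
          symm := fun h => ⟨h.2, h.1⟩
          trans := by
            rintro x _ _ ⟨⟨a, rfl⟩, ⟨b, hb⟩⟩ ⟨⟨c, rfl⟩, ⟨d, hd⟩⟩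
            exact ⟨⟨c + a, Function.iterate_add_apply ..⟩,
              ⟨b + d, by rw [Function.iterate_add_apply, hd, hb]⟩⟩ } }
  let root : V → V := fun x => (Quotient.mk s x).out
  have hroot : ∀ x, s (root x) x := fun x => Quotient.mk_out x
  have hroot_eq : ∀ x y, s x y → root x = root y := fun x y h =>
    congrArg Quotient.out (Quotient.sound h)
  have key : ∀ r r', root r = r → root r' = r' → s r r' → r = r' := fun r r' h h' hs => by
    rw [← h, ← h', hroot_eq r r' hs]
  refine ⟨{r | p r ≠ r ∧ root r = r ∧ s r (p r)}, fun r hr => hr.1, ?_, ?_⟩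
  · rintro ⟨⟨r, hr0, hr1, hr2⟩, b⟩ ⟨⟨r', hr0', hr1', hr2'⟩, b'⟩ h
    cases b <;> cases b' <;> simp only [Bool.false_eq_true, if_true, if_false] at h
    · have : r = r' := key r r' hr1 hr1' (s.trans hr2 (h ▸ s.symm hr2'))
      subst this
      rfl
    · have : r = r' := key r r' hr1 hr1' (h ▸ hr2)
      exact absurd (h.trans this.symm) hr0
    · have : r = r' := key r r' hr1 hr1' (s.symm (h ▸ hr2'))
      exact absurd (h.symm.trans this) hr0'
    · subst h
      rfl
  · intro x n hn hx hpx
    obtain ⟨⟨a, ha⟩, ⟨k, hk⟩⟩ := hroot x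
    have hper : p^[n] (root x) = root x := by
      rw [← hk, ← Function.iterate_add_apply, add_comm, Function.iterate_add_apply, hx]
    refine ⟨k, ?_⟩
    rw [hk]
    refine ⟨fun h => hpx ?_, hroot_eq _ _ (hroot x), ⟨1, rfl⟩, ⟨n - 1, ?_⟩⟩
    · have hx' : root x = x := by
        rw [Function.iterate_fixed h] at ha
        exact ha
      rwa [hx'] at h
    · rw [← Function.iterate_succ_apply, Nat.succ_eq_add_one, Nat.sub_add_cancel hn, hper]

/-- **Red-cycle elimination.** Let `I` be a `(q,q,0)`-canonical instance, `δ₀ ≤ 0.001`,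
and suppose a set of red edges of the light load graph is given such that every machine has
at most one incoming red edge and both endpoints of every red edge are red. Then there are
subsets `M'_j ⊆ M_j` with `z(M'_j) ≥ 0.49·z(M_j)` such that the red edges span no cycle
on `⋃_j M'_j`. -/
theorem red_cycle_elimination
    (M JH : Type) [Fintype M] [DecidableEq M] [Fintype JH]
    (Mach : JH → Finset M) (w : M → M → ℝ) (z : M → ℝ) (q δ0 : ℝ)
    (redE : M → M → Prop)
    (hc : IsPQCanonical Mach w z q q 0)
    (hδ00 : 0 < δ0) (hδ01 : δ0 ≤ 0.001)
    (hredEdge : ∀ k h, redE k h → k ≠ h ∧ 0 < w k h)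
    (hredUnique : ∀ h k k', redE k h → redE k' h → k = k')
    (hredRed : ∀ k h, redE k h → k ∈ redSet w z δ0 ∧ h ∈ redSet w z δ0) :
    ∃ Mach' : JH → Finset M,
      (∀ j, Mach' j ⊆ Mach j) ∧
      (∀ j, 0.49 * ∑ i ∈ Mach j, z i ≤ ∑ i ∈ Mach' j, z i) ∧
      (SimpleGraph.fromRel (fun k h => redE k h ∧
          k ∈ Finset.univ.biUnion Mach' ∧
          h ∈ Finset.univ.biUnion Mach')).IsAcyclic := by
  obtain ⟨⟨hdisj, -, -, -, hz, -⟩, -, -, -, -, -, -, hMach, hload⟩ := hc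
  have hzred : ∀ h ∈ redSet w z δ0, z h ≤ 0.001 := by
    intro h hh
    have h1 : deficiency w z h + z h < δ0 := (mem_filter.1 hh).2
    have h2 := hload h
    simp only [deficiency, sum_add_distrib] at h1
    linarith
  let p : M → M := fun h => if hk : ∃ k, redE k h then hk.choose else h
  have hp : ∀ k h, redE k h → p h = k := by
    intro k h hkh
    have hk : ∃ k, redE k h := ⟨k, hkh⟩
    simp only [p, dif_pos hk]
    exact hredUnique h _ _ hk.choose_spec hkh
  have hpne : ∀ h, p h ≠ h → redE (p h) h := by
    intro h hh
    by_cases hk : ∃ k, redE k h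
    · obtain ⟨k, hk⟩ := hk
      rwa [hp k h hk]
    · exact absurd (dif_neg hk) hh
  obtain ⟨Q, hQ, hinj, hQper⟩ := exists_pairs_of_periodic p
  let e : Q × Bool → M := fun x => if x.2 then x.1.1 else p x.1.1
  have hered : ∀ x, e x ∈ redSet w z δ0 := by
    rintro ⟨⟨r, hr⟩, b⟩
    have := hredRed _ _ (hpne r (hQ r hr))
    cases b
    · exact this.1
    · exact this.2
  have hlab : ∃ lab : M → Option JH, ∀ x j, lab x = some j ↔ x ∈ Mach j := by
    refine ⟨fun x => if h : ∃ j, x ∈ Mach j then some h.choose else none, fun x j => ?_⟩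
    by_cases h : ∃ j, x ∈ Mach j
    · simp only [dif_pos h, Option.some.injEq]
      refine ⟨fun hj => hj ▸ h.choose_spec, fun hj => ?_⟩
      by_contra hne
      exact Finset.disjoint_left.1 (hdisj hne) h.choose_spec hj
    · simp only [dif_neg h, reduceCtorEq, false_iff]
      exact fun hj => h ⟨j, hj⟩
  obtain ⟨lab, hlab⟩ := hlab
  obtain ⟨b, hb⟩ := exists_choice_sum_le (fun x => lab (e x)) (fun x => z (e x)) 0.001
    (by norm_num) (fun x => (hz _).1) (fun x => hzred _ (hered x))
  let D : Finset M := univ.image fun q : Q => e (q, b q)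
  refine ⟨fun j => Mach j \ D, fun j => sdiff_subset, fun j => ?_, ?_⟩
  · have h1 : ∑ i ∈ Mach j ∩ D, z i ≤
        ∑ q ∈ univ.filter (fun q => lab (e (q, b q)) = some j), z (e (q, b q)) := by
      have hsub : Mach j ∩ D =
          (univ.filter (fun q => lab (e (q, b q)) = some j)).image (fun q => e (q, b q)) := by
        ext i
        simp only [D, mem_inter, mem_image, mem_univ, true_and, mem_filter, hlab]
        constructor
        · rintro ⟨hi, q, rfl⟩
          exact ⟨q, hi, rfl⟩
        · rintro ⟨q, hi, rfl⟩
          exact ⟨hi, q, rfl⟩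
      rw [hsub, sum_image]
      intro q _ q' _ h
      exact congrArg Prod.fst (hinj h)
    have h2 : ∑ x ∈ univ.filter (fun x => lab (e x) = some j), z (e x) ≤
        ∑ i ∈ Mach j, z i := by
      rw [← sum_image (f := z) (s := univ.filter (fun x => lab (e x) = some j)) (g := e)
        (fun x _ y _ h => hinj h)]
      refine sum_le_sum_of_subset_of_nonneg ?_ fun i _ _ => (hz i).1
      intro i hi
      obtain ⟨x, hx, rfl⟩ := mem_image.1 hi
      exact (hlab _ _).1 (mem_filter.1 hx).2
    have h3 : ∑ q ∈ univ.filter (fun q => lab (e (q, b q)) = some j), z (e (q, b q)) ≤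
        (∑ x ∈ univ.filter (fun x => lab (e x) = some j), z (e x) + 0.001) / 2 := by
      convert hb (some j)
    have h4 := sum_inter_add_sum_sdiff (Mach j) D z
    have h5 := hMach j
    norm_num at h3 h5 ⊢
    linarith
  · intro v c hc
    have hU : ∀ x ∈ univ.biUnion (fun j => Mach j \ D), x ∉ D := by
      intro x hx
      obtain ⟨j, -, hx⟩ := mem_biUnion.1 hx
      exact (mem_sdiff.1 hx).2
    obtain ⟨x, n, hn, hx, hadj⟩ := exists_periodic_of_isCycle (p := p) (fun x y h => by
      rw [SimpleGraph.fromRel_adj] at h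
      exact h.2.imp (fun h => hp _ _ h.1) (fun h => hp _ _ h.1)) hc
    obtain ⟨k, hk⟩ := hQper x n hn hx (fun h => (hadj 0).ne h)
    have hmem : p (p^[k] x) ∉ D ∧ p^[k] x ∉ D := by
      have h := hadj k
      rw [SimpleGraph.fromRel_adj] at h
      rcases h.2 with h | h
      · exact ⟨hU _ h.2.1, hU _ h.2.2⟩
      · exact ⟨hU _ h.2.2, hU _ h.2.1⟩
    have hD : e (⟨_, hk⟩, b ⟨_, hk⟩) ∈ D := mem_image_of_mem _ (mem_univ _)
    cases hbk : b ⟨_, hk⟩ <;> rw [hbk] at hD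
    · exact hmem.1 hD
    · exact hmem.2 hD
end
end
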